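/- Let J ⊆ S¹ be an open arc whose complement has nonempty interior. Then for each 1 ≤ i ≤ n and each s ∈ {1, −1} there exists γ ∈ ⟨X⟩ such that x·γ = x·f_i^s for all x ∈ J. -/

import Mathlib

open Set

noncomputable section

/-- The circle `S¹ = ℝ/ℤ`. -/
abbrev S1 : Type := AddCircle (1 : ℝ)

/-- A bijection of `S¹` is an orientation-preserving homeomorphism if it admits a lift
to an increasing map `h : ℝ → ℝ` with `h (x + 1) = h x + 1`. -/
def CircleOP (f : Equiv.Perm S1) : Prop :=
  ∃ h : ℝ → ℝ, StrictMono h ∧ (∀ x : ℝ, h (x + 1) = h x + 1) ∧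
    ∀ x : ℝ, ((h x : ℝ) : S1) = f (x : S1)

/-- `ringIter f i x l` is the point `x · f_i f_{i+1} ⋯ f_{i+l}` (right action:
apply `f_i` first). -/
def ringIter {n : ℕ} (f : ZMod n → Equiv.Perm S1) (i : ZMod n) (x : S1) : ℕ → S1
  | 0 => f i x
  | l + 1 => f (i + (l : ZMod n) + 1) (ringIter f i x l)

/-- A fast `n`-ring of intervals and homeomorphisms on `S¹` (Definition 1.3 of the
paper), together with the dynamical condition `(*)`. The arcs `J i` are proper open
connected subsets covering `S¹`; consecutive arcs overlap in a proper nonempty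
connected subarc and non-consecutive arcs are disjoint; `f i` is an
orientation-preserving homeomorphism with support exactly `J i`; `x i` is the endpoint
of `J (i+1)` lying in `J i`; and `(*)` holds. -/
structure FastRing (n : ℕ) where
  J : ZMod n → Set S1
  f : ZMod n → Equiv.Perm S1
  x : ZMod n → S1
  isOpen' : ∀ i, IsOpen (J i)
  isConn : ∀ i, IsConnected (J i)
  proper : ∀ i, J i ≠ Set.univ
  covers : (⋃ i, J i) = Set.univ
  disj : ∀ i j : ZMod n, i ≠ j → i - j ≠ 1 → j - i ≠ 1 → J i ∩ J j = ∅
  adj_nonempty : ∀ i, (J i ∩ J (i + 1)).Nonempty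
  adj_conn : ∀ i, IsConnected (J i ∩ J (i + 1))
  adj_ssub_left : ∀ i, J i ∩ J (i + 1) ⊂ J i
  adj_ssub_right : ∀ i, J i ∩ J (i + 1) ⊂ J (i + 1)
  orient : ∀ i, CircleOP (f i)
  supp : ∀ i, {p : S1 | f i p ≠ p} = J i
  x_mem : ∀ i, x i ∈ J i
  x_endpoint : ∀ i, x i ∈ frontier (J (i + 1))
  fast : ∀ i : ZMod n, ∀ l : ℕ, 1 ≤ l → l ≤ n →
    ringIter f i (x i) l ∈ J (i + (l : ZMod n) + 1)

/-- The fast `n`-ring group `G_n = ⟨f₁, …, f_n⟩`. -/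
def Gn {n : ℕ} (R : FastRing n) : Subgroup (Equiv.Perm S1) :=
  Subgroup.closure (Set.range R.f)

/-- The derived subgroup `H_n = [G_n, G_n]`. -/
def Hn {n : ℕ} (R : FastRing n) : Subgroup (Equiv.Perm S1) := ⁅Gn R, Gn R⁆

/-- Minimality of the action of a group `G` of bijections of `S¹`: every orbit is
dense. -/
def MinimalAct (G : Subgroup (Equiv.Perm S1)) : Prop :=
  ∀ p : S1, Dense {q : S1 | ∃ g ∈ G, g p = q}

/-- An open arc of `S¹` is *small* (w.r.t. the ring `R`) if it is contained in some
`J k`. -/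
def IsSmallArc {n : ℕ} (R : FastRing n) (I : Set S1) : Prop :=
  IsOpen I ∧ IsConnected I ∧ ∃ k : ZMod n, I ⊆ R.J k

/-- A subset `S ⊆ S¹` is `ℐ`-small (w.r.t. the family `ℐ = {L i j}`) if it is contained
in a small open arc `I` such that, for all `i j`: if `I` meets `L i j` then `I` misses
`J j`, and if `I` meets `J j` then `I` misses `L i j`. -/
def ISmallSet {n : ℕ} (R : FastRing n) (L : ZMod n → ZMod n → Set S1) (S : Set S1) :
    Prop :=
  ∃ I : Set S1, IsSmallArc R I ∧
    (∀ i j : ZMod n, (I ∩ L i j).Nonempty → I ∩ R.J j = ∅) ∧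
    (∀ i j : ZMod n, (I ∩ R.J j).Nonempty → I ∩ L i j = ∅) ∧
    S ⊆ I

/-- `ν_{i,j} = λ_{i,j}⁻¹ f_i λ_{i,j}` (in the right-action convention; as a
left-composition permutation this is `λ_{i,j} ∘ f_i ∘ λ_{i,j}⁻¹`). -/
def nuEl {n : ℕ} (R : FastRing n) (lam : ZMod n → ZMod n → Equiv.Perm S1)
    (i j : ZMod n) : Equiv.Perm S1 :=
  lam i j * R.f i * (lam i j)⁻¹

/-- The finite generating set `X = {ν_{i,j}⁻¹ f_i : 1 ≤ i, j ≤ n}` (right-action words;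
`ν_{i,j}⁻¹ f_i` applies `ν_{i,j}⁻¹` first, i.e. it is the permutation
`f_i ∘ ν_{i,j}⁻¹`). -/
def Xset {n : ℕ} (R : FastRing n) (lam : ZMod n → ZMod n → Equiv.Perm S1) :
    Set (Equiv.Perm S1) :=
  {p : Equiv.Perm S1 | ∃ i j : ZMod n, p = R.f i * (nuEl R lam i j)⁻¹}

/-- The element `f · ν_{i,j}⁻¹` is a *special element* of `⟨X⟩` if it lies in `⟨X⟩`,
the supports of `f` and `ν_{i,j}` are disjoint, and the support of `f` is `ℐ`-small. -/
def SpecialEl {n : ℕ} (R : FastRing n) (L : ZMod n → ZMod n → Set S1)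
    (lam : ZMod n → ZMod n → Equiv.Perm S1) (f : Equiv.Perm S1) (i j : ZMod n) : Prop :=
  (nuEl R lam i j)⁻¹ * f ∈ Subgroup.closure (Xset R lam) ∧
  {p : S1 | f p ≠ p} ∩ {p : S1 | nuEl R lam i j p ≠ p} = ∅ ∧
  ISmallSet R L {p : S1 | f p ≠ p}

/-- The lift of an orientation-preserving circle homeomorphism commutes with integer
translations. -/
lemma lift_add_int {h : ℝ → ℝ} (h1 : ∀ x : ℝ, h (x + 1) = h x + 1) (x : ℝ) (N : ℤ) :
    h (x + N) = h x + N := by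
  induction N using Int.induction_on with
  | zero => simp
  | succ k ih =>
    have := h1 (x + k)
    push_cast at ih ⊢
    rw [← add_assoc, this, ih, add_assoc]
  | pred k ih =>
    have := h1 (x + (-k - 1))
    push_cast at ih ⊢
    rw [show x + (-(k : ℝ) - 1) + 1 = x + -k by ring, ih] at this
    linarith

lemma coe_S1_eq_iff {x y : ℝ} : (x : S1) = y ↔ ∃ N : ℤ, x = y + N := by
  rw [← sub_eq_zero, ← AddCircle.coe_sub, AddCircle.coe_eq_zero_iff]
  refine exists_congr fun N => ?_
  rw [zsmul_one, eq_comm, sub_eq_iff_eq_add']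

lemma CircleOP.continuous {f : Equiv.Perm S1} (hf : CircleOP f) : Continuous f := by
  obtain ⟨h, hmono, h1, hlift⟩ := hf
  have hsurj : Function.Surjective h := fun y => by
    obtain ⟨z, hz⟩ := f.surjective (y : S1)
    obtain ⟨x, rfl⟩ := QuotientAddGroup.mk_surjective z
    have hxy : ((h x : ℝ) : S1) = (y : S1) := (hlift x).trans hz
    obtain ⟨N, hN⟩ := coe_S1_eq_iff.1 hxy
    have := lift_add_int h1 x (-N)
    exact ⟨x + (-N : ℤ), by rw [this, hN]; push_cast; ring⟩
  have hcont : Continuous h := hmono.monotone.continuous_of_surjective hsurj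
  refine (QuotientAddGroup.isQuotientMap_mk _).continuous_iff.2 ?_
  have : (f ∘ ((↑) : ℝ → S1)) = fun x => ((h x : ℝ) : S1) := funext fun x => (hlift x).symm
  exact this ▸ (AddCircle.continuous_mk' 1).comp hcont

lemma continuous_perm_inv {f : Equiv.Perm S1} (hf : Continuous f) :
    Continuous (f⁻¹ : Equiv.Perm S1) :=
  (hf.homeoOfEquivCompactToT2 (f := f)).symm.continuous

lemma continuous_of_mem_Gn {n : ℕ} {R : FastRing n} {g : Equiv.Perm S1} (hg : g ∈ Gn R) :
    Continuous g := by
  induction hg using Subgroup.closure_induction with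
  | mem g hg =>
    obtain ⟨k, rfl⟩ := hg
    exact (R.orient k).continuous
  | one => exact continuous_id
  | mul a b _ _ ha hb => exact ha.comp hb
  | inv a _ ha => exact continuous_perm_inv ha

/-- In the coordinate cut at a fixed point, an orientation-preserving circle homeomorphism is
strictly increasing. -/
lemma CircleOP.equivIco_lt {f : Equiv.Perm S1} (hf : CircleOP f) {c : ℝ}
    (hc : f (c : S1) = c) {p q : S1}
    (hpq : (AddCircle.equivIco 1 c p : ℝ) < AddCircle.equivIco 1 c q) :
    (AddCircle.equivIco 1 c (f p) : ℝ) < AddCircle.equivIco 1 c (f q) := by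
  obtain ⟨h, hmono, h1, hlift⟩ := hf
  obtain ⟨N, hN⟩ : ∃ N : ℤ, h c = c + N :=
    coe_S1_eq_iff.1 ((hlift c).trans hc)
  have key : ∀ p : S1, (AddCircle.equivIco 1 c (f p) : ℝ) = h (AddCircle.equivIco 1 c p) - N := by
    intro p
    have hp := (AddCircle.equivIco 1 c p).2
    have hcoe : (((AddCircle.equivIco 1 c p : ℝ)) : S1) = p := AddCircle.coe_equivIco
    have hmem : h (AddCircle.equivIco 1 c p) - N ∈ Ico c (c + 1) := by
      have ha := hmono.monotone hp.1
      have hb := hmono hp.2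
      rw [h1] at hb
      constructor <;> linarith
    have hfp : f p = ((h (AddCircle.equivIco 1 c p) - N : ℝ) : S1) := by
      rw [← hcoe, ← hlift, hcoe]
      exact coe_S1_eq_iff.2 ⟨N, (sub_add_cancel _ _).symm⟩
    rw [hfp, AddCircle.equivIco_coe_of_mem hmem]
  rw [key, key]
  linarith [hmono hpq]

/-- Iterating a fixed-point-free increasing bijection of an interval, or its inverse, pushes
everything below a given point towards the lower end of the interval. -/
lemma exists_zpow_push {α : Type*} {e : α → ℝ} (he : Function.Injective e)
    (hbdd : BddBelow (range e)) {f : Equiv.Perm α}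
    (hf : ∀ x y, e x < e y → e (f x) < e (f y)) {J : Set α} (hJ : (e '' J).OrdConnected)
    (hfix : ∀ x ∈ J, f x ≠ x) {q : α} (hq : q ∈ J) :
    ∃ a : ℝ, (∀ x ∈ J, a < e x) ∧
      ∀ ε > 0, ∃ m : ℤ, ∀ x, e x < e q → e ((f ^ m) x) < a + ε := by
  have hlin : ∀ x y, e x < e y ↔ e (f x) < e (f y) := fun x y => by
    refine ⟨hf x y, fun h => ?_⟩
    rcases lt_trichotomy (e x) (e y) with h' | h' | h'
    · exact h'
    · exact absurd h (he h' ▸ lt_irrefl _)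
    · exact absurd h (hf y x h').le.not_gt
  obtain ⟨s, hgq, hgfix, hg⟩ : ∃ s : ℤ, e ((f ^ s) q) < e q ∧ (∀ x ∈ J, (f ^ s) x ≠ x) ∧
      ∀ x y, e x < e y ↔ e ((f ^ s) x) < e ((f ^ s) y) := by
    have hne : e (f q) ≠ e q := fun h => hfix q hq (he h)
    rcases lt_or_gt_of_ne hne with h | h
    · exact ⟨1, by simpa using h, by simpa using hfix, by simpa using hlin⟩
    · refine ⟨-1, ?_, fun x hx h' => hfix x hx ?_, fun x y => ?_⟩
      · rw [hlin]; simpa using h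
      · rw [zpow_neg_one, Equiv.Perm.inv_eq_iff_eq] at h'
        exact h'.symm
      · rw [hlin ((f ^ (-1 : ℤ)) x)]; simp
  set g := f ^ s
  have hiter : ∀ (m : ℕ) x y, e x < e y → e ((g ^ m) x) < e ((g ^ m) y) := by
    intro m
    induction m with
    | zero => simp
    | succ m ih =>
      intro x y hxy
      rw [pow_succ', Equiv.Perm.mul_apply, Equiv.Perm.mul_apply, ← hg]
      exact ih x y hxy
  have hbdd' : BddBelow (range fun m : ℕ => e ((g ^ m) q)) :=
    hbdd.mono (range_subset_iff.2 fun m => mem_range_self _)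
  set a := ⨅ m : ℕ, e ((g ^ m) q)
  have hlt : ∀ m : ℕ, a < e ((g ^ m) q) := fun m =>
    (ciInf_le hbdd' (m + 1)).trans_lt (by
      rw [pow_succ, Equiv.Perm.mul_apply]
      exact hiter m _ _ hgq)
  have haJ : a ∉ e '' J := by
    rintro ⟨t, htJ, hta⟩
    refine hgfix t htJ (he (le_antisymm ?_ ?_))
    · rw [hta]
      refine le_ciInf fun m => ?_
      cases m with
      | zero => exact (((hg _ _).1 (hta ▸ hlt 0)).trans hgq).le
      | succ m =>
        rw [pow_succ', Equiv.Perm.mul_apply]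
        exact ((hg _ _).1 (hta ▸ hlt m)).le
    · refine le_of_not_gt fun h => ?_
      rw [hta] at h
      have h' : e t < e (g⁻¹ t) := by rw [hg]; simpa [hta] using h
      rw [hta] at h'
      obtain ⟨m, hm⟩ := exists_lt_of_ciInf_lt h'
      have := (hg _ _).1 hm
      rw [← Equiv.Perm.mul_apply, ← pow_succ', Equiv.Perm.inv_def,
        Equiv.apply_symm_apply, hta] at this
      exact this.not_gt (hlt (m + 1))
  refine ⟨a, fun x hx => lt_of_not_ge fun h => haJ ?_, fun ε hε => ?_⟩
  · exact hJ.out (mem_image_of_mem e hx) (mem_image_of_mem e hq) ⟨h, (hlt 0).le⟩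
  · obtain ⟨m, hm⟩ := exists_lt_of_ciInf_lt (lt_add_of_pos_right a hε)
    refine ⟨s * m, fun x hx => ?_⟩
    rw [zpow_mul, zpow_natCast]
    exact (hiter m x q hx).trans hm

/-- A connected set properly contained in an arc `J` is pushed by powers of a
homeomorphism with support `J` into arbitrarily small neighbourhoods of some point. -/
lemma exists_contraction_point {f : Equiv.Perm S1} (hf : CircleOP f) {J K : Set S1}
    (hsupp : {p : S1 | f p ≠ p} = J) (hJc : IsConnected J) (hJ : J ≠ univ)
    (hK : IsPreconnected K) (hKJ : K ⊂ J) :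
    ∃ p : S1, ∀ U : Set S1, IsOpen U → p ∈ U → ∃ m : ℤ, (f ^ m) '' K ⊆ U := by
  obtain ⟨hsub, q, hqJ, hqK⟩ := (ssubset_iff_exists.1 hKJ)
  obtain ⟨c', hc'⟩ := (ne_univ_iff_exists_notMem J).1 hJ
  obtain ⟨c, rfl⟩ := QuotientAddGroup.mk_surjective c'
  change ((c : ℝ) : S1) ∉ J at hc'
  have hfc : f (c : S1) = c := by
    by_contra h
    exact hc' (hsupp ▸ h)
  set e : S1 → ℝ := fun p => AddCircle.equivIco 1 c p
  have hcoe : ∀ p, ((e p : ℝ) : S1) = p := fun p => AddCircle.coe_equivIco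
  have hinj : Function.Injective e := Function.LeftInverse.injective hcoe
  have hmono : ∀ x y, e x < e y → e (f x) < e (f y) := fun x y => hf.equivIco_lt hfc
  have hcont : ContinuousOn e J := fun x hx =>
    (continuous_subtype_val.continuousAt.comp
      (AddCircle.continuousAt_equivIco 1 c fun h => hc' (h ▸ hx))).continuousWithinAt
  have hfix : ∀ x ∈ J, f x ≠ x := fun x hx => by
    rw [← hsupp] at hx
    exact hx
  have hinv : ∀ (m : ℤ), ∀ x ∈ J, (f ^ m) x ∈ J := fun m x hx => by
    rw [← hsupp] at hx ⊢
    intro h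
    apply hx
    rw [← Equiv.Perm.mul_apply, ← zpow_one_add, add_comm, zpow_add_one,
      Equiv.Perm.mul_apply] at h
    exact (f ^ m).injective h
  have hordJ := (hJc.isPreconnected.image e hcont).ordConnected
  have hordK := (hK.image e (hcont.mono hsub)).ordConnected
  have hside : (∀ x ∈ K, e x < e q) ∨ ∀ x ∈ K, e q < e x := by
    by_contra! h
    obtain ⟨⟨x, hx, hqx⟩, y, hy, hyq⟩ := h
    obtain ⟨z, hz, hzq⟩ :=
      hordK.out (mem_image_of_mem e hy) (mem_image_of_mem e hx) ⟨hyq, hqx⟩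
    exact hqK (hinj hzq ▸ hz)
  have hball : ∀ (a : ℝ) (U : Set S1), IsOpen U → (a : S1) ∈ U →
      ∃ ε > 0, ∀ t : ℝ, |t - a| < ε → (t : S1) ∈ U := fun a U hU ha =>
    Metric.isOpen_iff.1 (hU.preimage (AddCircle.continuous_mk' 1)) a ha
  rcases hside with hside | hside
  · obtain ⟨a, haJ, ha⟩ := exists_zpow_push hinj
      ⟨c, by rintro _ ⟨p, rfl⟩; exact (AddCircle.equivIco 1 c p).2.1⟩ hmono hordJ hfix hqJ
    refine ⟨a, fun U hU haU => ?_⟩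
    obtain ⟨ε, hε, hεU⟩ := hball a U hU haU
    obtain ⟨m, hm⟩ := ha ε hε
    refine ⟨m, ?_⟩
    rintro _ ⟨x, hx, rfl⟩
    rw [← hcoe ((f ^ m) x)]
    have h1 := haJ _ (hinv m x (hsub hx))
    have h2 := hm x (hside x hx)
    exact hεU _ (abs_lt.2 ⟨by linarith, by linarith⟩)
  · obtain ⟨a, haJ, ha⟩ := exists_zpow_push (e := fun p => -e p) (neg_injective.comp hinj)
      ⟨-(c + 1), by
        rintro _ ⟨p, rfl⟩
        exact neg_le_neg (AddCircle.equivIco 1 c p).2.2.le⟩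
      (fun x y h => neg_lt_neg (hmono y x (neg_lt_neg_iff.1 h)))
      (hJc.isPreconnected.image _ hcont.neg).ordConnected hfix hqJ
    refine ⟨((-a : ℝ) : S1), fun U hU haU => ?_⟩
    obtain ⟨ε, hε, hεU⟩ := hball (-a) U hU haU
    obtain ⟨m, hm⟩ := ha ε hε
    refine ⟨m, ?_⟩
    rintro _ ⟨x, hx, rfl⟩
    rw [← hcoe ((f ^ m) x)]
    have h1 := haJ _ (hinv m x (hsub hx))
    have h2 := hm x (neg_lt_neg (hside x hx))
    exact hεU _ (abs_lt.2 ⟨by linarith, by linarith⟩)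

lemma commute_of_disjoint_supports {f g : Equiv.Perm S1} {A B : Set S1} (hAB : A ∩ B = ∅)
    (hf : {p : S1 | f p ≠ p} ⊆ A) (hg : {p : S1 | g p ≠ p} ⊆ B) : Commute f g :=
  Equiv.Perm.Disjoint.commute fun p => by
    by_contra! h
    exact (hAB ▸ (⟨hf h.1, hg h.2⟩ : p ∈ A ∩ B) : p ∈ (∅ : Set S1))

lemma support_conj (f g : Equiv.Perm S1) :
    {p : S1 | (g * f * g⁻¹) p ≠ p} = g '' {p : S1 | f p ≠ p} := by
  ext p
  rw [Equiv.image_eq_preimage_symm]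
  simp only [mem_ofPred_eq, mem_preimage, Equiv.Perm.mul_apply, ne_eq]
  rw [← Equiv.Perm.eq_inv_iff_eq]
  rfl

lemma support_nuEl {n : ℕ} (R : FastRing n) (lam : ZMod n → ZMod n → Equiv.Perm S1)
    (i j : ZMod n) : {p : S1 | nuEl R lam i j p ≠ p} = lam i j '' R.J i := by
  rw [nuEl, support_conj, R.supp]

lemma mul_nuEl_inv_mem {n : ℕ} (R : FastRing n) (lam : ZMod n → ZMod n → Equiv.Perm S1)
    (i j : ZMod n) : R.f i * (nuEl R lam i j)⁻¹ ∈ Subgroup.closure (Xset R lam) :=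
  Subgroup.subset_closure ⟨i, j, rfl⟩

/-- The coset of `f_i` modulo `⟨X⟩` is stable under conjugating elements supported in `J_k`
by powers of `f_k`. -/
lemma conj_zpow_mul_inv_mem {n : ℕ} (R : FastRing n) (L : ZMod n → ZMod n → Set S1)
    (hLdisj : ∀ i j i' j' : ZMod n, (i, j) ≠ (i', j') → L i j ∩ L i' j' = ∅)
    (hLJ : ∀ i j, L i j ∩ R.J j = ∅)
    (lam : ZMod n → ZMod n → Equiv.Perm S1)
    (hlamI : ∀ i j, (fun p : S1 => lam i j p) '' R.J i ⊆ L i j)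
    {i k : ZMod n} {h : Equiv.Perm S1}
    (hmem : h * (R.f i)⁻¹ ∈ Subgroup.closure (Xset R lam))
    (hsupp : {p : S1 | h p ≠ p} ⊆ R.J k) (m : ℤ) :
    R.f k ^ m * h * (R.f k ^ m)⁻¹ * (R.f i)⁻¹ ∈ Subgroup.closure (Xset R lam) := by
  have hν : ∀ a b, {p : S1 | nuEl R lam a b p ≠ p} ⊆ L a b := fun a b =>
    (support_nuEl R lam a b).trans_subset (hlamI a b)
  have hνf : ∀ a, Commute (nuEl R lam a k) (R.f k) := fun a =>
    commute_of_disjoint_supports (hLJ a k) (hν a k) (R.supp k).subset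
  have hνh : Commute (nuEl R lam k k) h :=
    commute_of_disjoint_supports (hLJ k k) (hν k k) hsupp
  have hνν : Commute (nuEl R lam k k) (nuEl R lam i k) := by
    by_cases hik : k = i
    · subst hik; exact Commute.refl _
    · exact commute_of_disjoint_supports (hLdisj k k i k (by simp [hik])) (hν k k) (hν i k)
  set N := nuEl R lam k k
  set M := nuEl R lam i k
  set x := R.f k * N⁻¹ with hx
  have hxm : x ^ m = R.f k ^ m * (N ^ m)⁻¹ := by
    rw [hx, (hνf k).symm.inv_right.mul_zpow, inv_zpow]
  have hM : Commute (x ^ m) M :=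
    (((hνf i).symm).mul_left hνν.inv_left).zpow_left m
  have hNh : (N ^ m)⁻¹ * h * N ^ m = h := by
    rw [((hνh.zpow_left m).inv_left).eq, inv_mul_cancel_right]
  have hxm_mem : x ^ m ∈ Subgroup.closure (Xset R lam) :=
    Subgroup.zpow_mem _ (mul_nuEl_inv_mem R lam k k) m
  have hfM := mul_nuEl_inv_mem R lam i k
  have := Subgroup.mul_mem _ (Subgroup.mul_mem _ (Subgroup.mul_mem _ hxm_mem
    (Subgroup.mul_mem _ hmem hfM)) (Subgroup.inv_mem _ hxm_mem)) (Subgroup.inv_mem _ hfM)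
  convert this using 1
  calc R.f k ^ m * h * (R.f k ^ m)⁻¹ * (R.f i)⁻¹
      = R.f k ^ m * ((N ^ m)⁻¹ * h * N ^ m) * (R.f k ^ m)⁻¹ * (R.f i)⁻¹ := by rw [hNh]
    _ = x ^ m * h * (x ^ m)⁻¹ * (R.f i)⁻¹ := by rw [hxm]; group
    _ = x ^ m * h * (M⁻¹ * (x ^ m)⁻¹ * M) * (R.f i)⁻¹ := by
        rw [(hM.inv_inv).symm.eq, inv_mul_cancel_right]
    _ = _ := by simp only [M]; group

/-- A point `p` is an accumulation point for the coset of `f_i` if every neighbourhood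
of `p` contains the support of an element of `⟨X⟩ f_i`. -/
def CosetAccum {n : ℕ} (R : FastRing n) (lam : ZMod n → ZMod n → Equiv.Perm S1)
    (i : ZMod n) (p : S1) : Prop :=
  ∀ U : Set S1, IsOpen U → p ∈ U → ∃ h : Equiv.Perm S1,
    h * (R.f i)⁻¹ ∈ Subgroup.closure (Xset R lam) ∧ {q : S1 | h q ≠ q} ⊆ U

lemma CosetAccum.zpow {n : ℕ} {R : FastRing n} {L : ZMod n → ZMod n → Set S1}
    (hLdisj : ∀ i j i' j' : ZMod n, (i, j) ≠ (i', j') → L i j ∩ L i' j' = ∅)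
    (hLJ : ∀ i j, L i j ∩ R.J j = ∅)
    {lam : ZMod n → ZMod n → Equiv.Perm S1}
    (hlamI : ∀ i j, (fun p : S1 => lam i j p) '' R.J i ⊆ L i j)
    {i : ZMod n} {p : S1} (hp : CosetAccum R lam i p) (k : ZMod n) (m : ℤ) :
    CosetAccum R lam i ((R.f k ^ m) p) := by
  by_cases hpk : p ∈ R.J k
  · intro U hU hpU
    have hcont : Continuous (R.f k ^ m : Equiv.Perm S1) :=
      continuous_of_mem_Gn (R := R)
        (Subgroup.zpow_mem _ (Subgroup.subset_closure (mem_range_self k)) m)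
    obtain ⟨h, hmem, hsupp⟩ :=
      hp ((R.f k ^ m : Equiv.Perm S1) ⁻¹' U ∩ R.J k) ((hU.preimage hcont).inter (R.isOpen' k))
        ⟨hpU, hpk⟩
    refine ⟨_, conj_zpow_mul_inv_mem R L hLdisj hLJ lam hlamI hmem
      (hsupp.trans inter_subset_right) m, ?_⟩
    rw [support_conj]
    exact image_subset_iff.2 (hsupp.trans inter_subset_left)
  · have hfix : R.f k p = p := by
      by_contra h
      exact hpk (R.supp k ▸ h)
    rwa [Equiv.Perm.zpow_apply_eq_self_of_apply_eq_self hfix]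

/-- Some `ν_{i,j}` has support properly contained in some `J_k`. -/
lemma exists_image_ssubset {n : ℕ} (hn : 3 ≤ n) (R : FastRing n)
    (L : ZMod n → ZMod n → Set S1) (hLarc : ∀ i j, IsSmallArc R (L i j))
    (hLdisj : ∀ i j i' j' : ZMod n, (i, j) ≠ (i', j') → L i j ∩ L i' j' = ∅)
    (lam : ZMod n → ZMod n → Equiv.Perm S1)
    (hlamI : ∀ i j, (fun p : S1 => lam i j p) '' R.J i ⊆ L i j) (i : ZMod n) :
    ∃ j k, lam i j '' R.J i ⊂ R.J k := by
  by_contra! hcon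
  choose _ _ k hk using fun j => hLarc i j
  have hJk : ∀ j, R.J (k j) ⊆ L i j := fun j => by
    have hsub : lam i j '' R.J i ⊆ R.J (k j) := (hlamI i j).trans (hk j)
    have hsup : R.J (k j) ⊆ lam i j '' R.J i := by
      by_contra h
      exact hcon j (k j) ⟨hsub, h⟩
    exact hsup.trans (hlamI i j)
  have hdisj : ∀ a b, a ≠ b → R.J (k a) ∩ R.J (k b) = ∅ := fun a b hab =>
    subset_empty_iff.1 ((inter_subset_inter (hJk a) (hJk b)).trans
      (hLdisj i a i b (by simp [hab])).subset)
  have : NeZero n := ⟨by omega⟩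
  have : Fact (1 < n) := ⟨by omega⟩
  have hinj : Function.Injective k := fun a b hab => by
    by_contra hne
    have := hdisj a b hne
    rw [hab, inter_self] at this
    exact (R.isConn (k b)).nonempty.ne_empty this
  obtain ⟨a, ha⟩ := Finite.surjective_of_injective hinj 0
  obtain ⟨b, hb⟩ := Finite.surjective_of_injective hinj (0 + 1)
  have hab : a ≠ b := by
    rintro rfl
    exact zero_ne_one ((ha.symm.trans hb).trans (zero_add 1))
  have hne := R.adj_nonempty 0
  rw [← hb, ← ha, hdisj a b hab] at hne
  exact not_nonempty_empty hne

lemma exists_cosetAccum {n : ℕ} (hn : 3 ≤ n) (R : FastRing n)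
    (L : ZMod n → ZMod n → Set S1) (hLarc : ∀ i j, IsSmallArc R (L i j))
    (hLdisj : ∀ i j i' j' : ZMod n, (i, j) ≠ (i', j') → L i j ∩ L i' j' = ∅)
    (hLJ : ∀ i j, L i j ∩ R.J j = ∅)
    (lam : ZMod n → ZMod n → Equiv.Perm S1) (hlam : ∀ i j, lam i j ∈ Gn R)
    (hlamI : ∀ i j, (fun p : S1 => lam i j p) '' R.J i ⊆ L i j) (i : ZMod n) :
    ∃ p, CosetAccum R lam i p := by
  obtain ⟨j, k, hjk⟩ := exists_image_ssubset hn R L hLarc hLdisj lam hlamI i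
  obtain ⟨p, hp⟩ := exists_contraction_point (R.orient k) (R.supp k) (R.isConn k) (R.proper k)
    ((R.isConn i).isPreconnected.image _ (continuous_of_mem_Gn (hlam i j)).continuousOn) hjk
  refine ⟨p, fun U hU hpU => ?_⟩
  obtain ⟨m, hm⟩ := hp U hU hpU
  have hmem : nuEl R lam i j * (R.f i)⁻¹ ∈ Subgroup.closure (Xset R lam) := by
    simpa using Subgroup.inv_mem _ (mul_nuEl_inv_mem R lam i j)
  refine ⟨_, conj_zpow_mul_inv_mem R L hLdisj hLJ lam hlamI hmem
    ((support_nuEl R lam i j).trans_subset hjk.subset) m, ?_⟩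
  rwa [support_conj, support_nuEl]

/-- Every nonempty open set contains the support of an element of `⟨X⟩ f_i`. -/
lemma exists_coset_support_subset {n : ℕ} (hn : 3 ≤ n) (R : FastRing n)
    (hmin : MinimalAct (Gn R))
    (L : ZMod n → ZMod n → Set S1) (hLarc : ∀ i j, IsSmallArc R (L i j))
    (hLdisj : ∀ i j i' j' : ZMod n, (i, j) ≠ (i', j') → L i j ∩ L i' j' = ∅)
    (hLJ : ∀ i j, L i j ∩ R.J j = ∅)
    (lam : ZMod n → ZMod n → Equiv.Perm S1) (hlam : ∀ i j, lam i j ∈ Gn R)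
    (hlamI : ∀ i j, (fun p : S1 => lam i j p) '' R.J i ⊆ L i j) (i : ZMod n)
    {W : Set S1} (hW : IsOpen W) (hWne : W.Nonempty) :
    ∃ h : Equiv.Perm S1, h * (R.f i)⁻¹ ∈ Subgroup.closure (Xset R lam) ∧
      {q : S1 | h q ≠ q} ⊆ W := by
  obtain ⟨p, hp⟩ := exists_cosetAccum hn R L hLarc hLdisj hLJ lam hlam hlamI i
  obtain ⟨_, hqW, g, hg, rfl⟩ := (hmin p).inter_open_nonempty W hW hWne
  have hinv : ∀ q, CosetAccum R lam i q ↔ CosetAccum R lam i (g q) := by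
    clear hqW
    induction hg using Subgroup.closure_induction with
    | mem g hg =>
      obtain ⟨k, rfl⟩ := hg
      exact fun q => ⟨fun hq => by simpa using hq.zpow hLdisj hLJ hlamI k 1,
        fun hq => by simpa using hq.zpow hLdisj hLJ hlamI k (-1)⟩
    | one => simp
    | mul a b _ _ ha hb => exact fun q => (hb q).trans (ha (b q))
    | inv a _ ha => exact fun q => by simpa using (ha (a⁻¹ q)).symm
  exact (hinv p).1 hp W hW hqW

/-- Lemma 3.8 of the paper. For every open arc `J ⊆ S¹` whose
complement has nonempty interior, each `i` and each `s ∈ {1, -1}`, there is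
`γ ∈ ⟨X⟩` agreeing with `f_i^s` on `J`. -/
theorem stmt_17 (n : ℕ) (hn : 3 ≤ n) (R : FastRing n) (hmin : MinimalAct (Gn R))
    (L : ZMod n → ZMod n → Set S1)
    (hLarc : ∀ i j, IsSmallArc R (L i j))
    (hLdisj : ∀ i j i' j' : ZMod n, (i, j) ≠ (i', j') → L i j ∩ L i' j' = ∅)
    (hLint : ∀ i j, L i j ⊆ interior ((R.J j)ᶜ))
    (lam : ZMod n → ZMod n → Equiv.Perm S1)
    (hlam : ∀ i j, lam i j ∈ Gn R)
    (hlamI : ∀ i j, (fun p : S1 => lam i j p) '' R.J i ⊆ L i j)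
    (V : Set S1) (hVopen : IsOpen V) (hVconn : IsConnected V)
    (hVc : (interior Vᶜ).Nonempty)
    (i : ZMod n) (s : ℤ) (hs : s = 1 ∨ s = -1) :
    ∃ γ ∈ Subgroup.closure (Xset R lam), ∀ p ∈ V, γ p = (R.f i ^ s) p := by
  have hLJ : ∀ i j, L i j ∩ R.J j = ∅ := fun i j =>
    disjoint_iff_inter_eq_empty.1
      (subset_compl_iff_disjoint_right.1 ((hLint i j).trans interior_subset))
  have key := fun {W : Set S1} => exists_coset_support_subset hn R hmin L hLarc hLdisj hLJ
    lam hlam hlamI i (W := W)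
  rcases hs with rfl | rfl
  · obtain ⟨h, hmem, hsupp⟩ := key isOpen_interior hVc
    refine ⟨(h * (R.f i)⁻¹)⁻¹, Subgroup.inv_mem _ hmem, fun p hp => ?_⟩
    have hfix : h p = p := by
      by_contra hne
      exact interior_subset (hsupp hne) hp
    rw [mul_inv_rev, inv_inv, zpow_one, Equiv.Perm.mul_apply,
      Equiv.Perm.inv_eq_iff_eq.2 hfix.symm]
  · obtain ⟨h, hmem, hsupp⟩ := key (isOpen_interior.preimage (R.orient i).continuous)
      (hVc.preimage (R.f i).surjective)
    refine ⟨_, hmem, fun p hp => ?_⟩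
    rw [zpow_neg_one, Equiv.Perm.mul_apply]
    by_contra hne
    have := interior_subset (hsupp hne)
    rw [Equiv.Perm.inv_def, Equiv.apply_symm_apply] at this
    exact this hp
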